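/- Fix an integer k ≥ 2 and constants 0 < c < C. There exists a constant C' > 0 (depending only on k, c, C) such that for all sufficiently large real N and every compact convex set D ⊆ [-CN,CN]^k ⊂ ℝ^k, the absolute value of the integral of g(t_1·t_2·⋯·t_k) over the set D ∩ ([cN,CN] × [-cN,cN]^{k-1}) with respect to Lebesgue measure is at most C'·(log N)^{k-2}. -/

import Mathlib

open MeasureTheory Real

/-- `g u = sin u / u`, extended by `g 0 = 1`. -/
noncomputable def g (u : ℝ) : ℝ := if u = 0 then 1 else Real.sin u / u

open Set in
/-- The sine integral is bounded. -/
theorem abs_integral_sinc_le_of_nonneg {x : ℝ} (hx : 0 ≤ x) :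
    |∫ u in (0 : ℝ)..x, sinc u| ≤ 4 := by
  have hsmall {y : ℝ} (h0 : 0 ≤ y) (h1 : y ≤ 1) : |∫ u in (0 : ℝ)..y, sinc u| ≤ 1 := by
    have := intervalIntegral.norm_integral_le_of_norm_le_const (a := 0) (b := y) (f := sinc)
      (C := 1) (fun u _ => abs_sinc_le_one u)
    rw [Real.norm_eq_abs, sub_zero, abs_of_nonneg h0] at this
    linarith
  rcases le_total x 1 with h1 | h1
  · linarith [hsmall hx h1]
  have hint (a b : ℝ) : IntervalIntegrable sinc volume a b :=
    continuous_sinc.intervalIntegrable a b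
  have hpos {u : ℝ} (hu : u ∈ uIcc 1 x) : 0 < u := by
    rw [uIcc_of_le h1] at hu
    linarith [hu.1]
  have hsq : IntervalIntegrable (fun u : ℝ => -(u ^ 2)⁻¹) volume 1 x := by
    refine ContinuousOn.intervalIntegrable fun u hu => ?_
    have := (hpos hu).ne'
    exact ContinuousAt.continuousWithinAt (by fun_prop (disch := positivity))
  have hsq' : IntervalIntegrable (fun u : ℝ => (u ^ 2)⁻¹) volume 1 x := by
    simpa only [Pi.neg_def, neg_neg] using hsq.neg
  have hparts : ∫ u in (1 : ℝ)..x, sinc u =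
      x⁻¹ * -cos x - (1 : ℝ)⁻¹ * -cos 1 - ∫ u in (1 : ℝ)..x, -(u ^ 2)⁻¹ * -cos u := by
    rw [← intervalIntegral.integral_mul_deriv_eq_deriv_mul (u := fun u : ℝ => u⁻¹)
      (v := fun u => -cos u) (v' := sin)
      (fun u hu => hasDerivAt_inv (hpos hu).ne')
      (fun u _ => by simpa using (hasDerivAt_cos u).fun_neg) hsq
      (continuous_sin.intervalIntegrable _ _)]
    refine intervalIntegral.integral_congr fun u hu => ?_
    simp only [sinc_of_ne_zero (hpos hu).ne', div_eq_inv_mul]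
  have hsqint : ∫ u in (1 : ℝ)..x, (u ^ 2)⁻¹ = 1 - x⁻¹ := by
    have := intervalIntegral.integral_eq_sub_of_hasDerivAt
      (fun u hu => hasDerivAt_inv (hpos hu).ne') hsq
    rw [intervalIntegral.integral_neg] at this
    simp only [inv_one] at this
    linarith
  have hrem : |∫ u in (1 : ℝ)..x, -(u ^ 2)⁻¹ * -cos u| ≤ 1 - x⁻¹ := by
    rw [← hsqint, ← Real.norm_eq_abs]
    refine intervalIntegral.norm_integral_le_of_norm_le h1
      (Filter.Eventually.of_forall fun u _ => ?_) hsq'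
    rw [neg_mul_neg, norm_mul, Real.norm_eq_abs, Real.norm_eq_abs,
      abs_of_nonneg (by positivity : 0 ≤ (u ^ 2)⁻¹)]
    exact mul_le_of_le_one_right (by positivity) (abs_cos_le_one u)
  have hxinv : 0 ≤ x⁻¹ := by positivity
  have hxinv1 : x⁻¹ ≤ 1 := inv_le_one_of_one_le₀ h1
  have hcos : |x⁻¹ * -cos x| ≤ 1 := by
    rw [abs_mul, abs_neg, abs_of_nonneg hxinv]
    exact mul_le_one₀ hxinv1 (abs_nonneg _) (abs_cos_le_one x)
  rw [← intervalIntegral.integral_add_adjacent_intervals (hint 0 1) (hint 1 x), hparts]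
  have h01 := hsmall zero_le_one le_rfl
  rw [abs_le] at h01 hcos hrem ⊢
  constructor <;> linarith [neg_one_le_cos 1, cos_le_one 1, h01.1, h01.2]

theorem abs_integral_sinc_le (x : ℝ) : |∫ u in (0 : ℝ)..x, sinc u| ≤ 4 := by
  rcases le_total 0 x with hx | hx
  · exact abs_integral_sinc_le_of_nonneg hx
  · have h := abs_integral_sinc_le_of_nonneg (neg_nonneg.2 hx)
    have hneg := intervalIntegral.integral_comp_neg (a := 0) (b := -x) sinc
    simp only [sinc_neg, neg_neg, neg_zero] at hneg
    rwa [hneg, intervalIntegral.integral_symm, abs_neg] at h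

theorem abs_setIntegral_sinc_mul_le {S : Set ℝ} (hS : IsCompact S) (hconv : Convex ℝ S)
    {p : ℝ} (hp : p ≠ 0) : |∫ x in S, sinc (p * x)| ≤ 8 / |p| := by
  rcases S.eq_empty_or_nonempty with rfl | hne
  · simp only [Measure.restrict_empty, integral_zero_measure, abs_zero]
    positivity
  have hIcc := eq_Icc_of_connected_compact ⟨hne, hconv.isPreconnected⟩ hS
  have hle : sInf S ≤ sSup S := Set.nonempty_Icc.1 (hIcc ▸ hne)
  rw [hIcc, integral_Icc_eq_integral_Ioc, ← intervalIntegral.integral_of_le hle,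
    intervalIntegral.integral_comp_mul_left _ hp,
    ← intervalIntegral.integral_interval_sub_left (a := 0)
      (continuous_sinc.intervalIntegrable _ _) (continuous_sinc.intervalIntegrable _ _),
    smul_eq_mul, abs_mul, abs_inv, div_eq_inv_mul]
  gcongr
  have h₁ := abs_integral_sinc_le (p * sSup S)
  have h₂ := abs_integral_sinc_le (p * sInf S)
  rw [abs_le] at *
  constructor <;> linarith

theorem intervalIntegrable_abs_rpow_zero {r a : ℝ} (hr : -1 < r) (ha : 0 ≤ a) :
    IntervalIntegrable (fun x : ℝ => |x| ^ r) volume 0 a := by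
  refine (intervalIntegral.intervalIntegrable_rpow' hr).congr fun x hx => ?_
  rw [Set.uIoc_of_le ha] at hx
  simp only [abs_of_pos hx.1]

theorem intervalIntegrable_abs_rpow_neg {r a : ℝ} (hr : -1 < r) (ha : 0 ≤ a) :
    IntervalIntegrable (fun x : ℝ => |x| ^ r) volume (-a) 0 := by
  have h := intervalIntegrable_abs_rpow_zero hr ha
  rw [IntervalIntegrable.iff_comp_neg] at h
  simpa only [abs_neg, neg_zero] using h.symm

theorem integrableOn_Icc_abs_rpow {r a : ℝ} (hr : -1 < r) (ha : 0 ≤ a) :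
    IntegrableOn (fun x : ℝ => |x| ^ r) (Set.Icc (-a) a) := by
  rw [← intervalIntegrable_iff_integrableOn_Icc_of_le (by linarith)]
  exact (intervalIntegrable_abs_rpow_neg hr ha).trans (intervalIntegrable_abs_rpow_zero hr ha)

theorem setIntegral_Icc_abs_rpow {r a : ℝ} (hr : -1 < r) (ha : 0 ≤ a) :
    ∫ x in Set.Icc (-a) a, |x| ^ r = 2 * (a ^ (r + 1) / (r + 1)) := by
  have hneg := intervalIntegral.integral_comp_neg (a := -a) (b := 0) fun x : ℝ => |x| ^ r
  simp only [abs_neg, neg_zero, neg_neg] at hneg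
  have hpos : ∫ x in (0 : ℝ)..a, |x| ^ r = a ^ (r + 1) / (r + 1) := by
    rw [intervalIntegral.integral_congr (g := fun x : ℝ => x ^ r),
      integral_rpow (.inl hr), zero_rpow (by linarith), sub_zero]
    intro x hx
    rw [Set.uIcc_of_le ha] at hx
    simp only [abs_of_nonneg hx.1]
  rw [integral_Icc_eq_integral_Ioc, ← intervalIntegral.integral_of_le (by linarith),
    ← intervalIntegral.integral_add_adjacent_intervals (intervalIntegrable_abs_rpow_neg hr ha)
      (intervalIntegrable_abs_rpow_zero hr ha), hneg, hpos, two_mul]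

open Set in
/-- Interpolating between the length bound and the oscillation bound. -/
theorem abs_setIntegral_sinc_mul_le_rpow {S : Set ℝ} (hS : IsCompact S) (hconv : Convex ℝ S)
    {a ε p : ℝ} (hp : p ≠ 0) (ha : 0 ≤ a) (hsub : S ⊆ Icc (-a) a) (hε : 0 < ε) (hε1 : ε ≤ 1) :
    |∫ x in S, sinc (p * x)| ≤ (2 * a) ^ ε * 8 ^ (1 - ε) * |p| ^ (ε - 1) := by
  have hosc := abs_setIntegral_sinc_mul_le hS hconv hp
  have hlen : |∫ x in S, sinc (p * x)| ≤ 2 * a := by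
    have h := norm_setIntegral_le_of_norm_le_const (μ := volume) (f := fun x => sinc (p * x))
      hS.measure_lt_top (C := 1) (fun x _ => abs_sinc_le_one _)
    have hvol : volume.real S ≤ 2 * a := by
      refine (measureReal_mono hsub (by simp)).trans ?_
      rw [Real.volume_real_Icc_of_le (by linarith)]
      linarith
    rw [Real.norm_eq_abs] at h
    linarith
  set z := |∫ x in S, sinc (p * x)|
  have hz : 0 ≤ z := abs_nonneg _
  calc z = z ^ ε * z ^ (1 - ε) := by
        rw [← rpow_add_of_nonneg hz hε.le (by linarith), add_sub_cancel, rpow_one]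
    _ ≤ (2 * a) ^ ε * (8 / |p|) ^ (1 - ε) := by
        have : 0 ≤ 1 - ε := by linarith
        gcongr
    _ = (2 * a) ^ ε * 8 ^ (1 - ε) * |p| ^ (ε - 1) := by
        rw [div_rpow (by norm_num) (abs_nonneg p), mul_assoc, div_eq_mul_inv,
          ← rpow_neg (abs_nonneg p), neg_sub]

/-- The weight dominating the integral over a fibre, in the `i`-th remaining coordinate. -/
noncomputable def fibreWeight {n : ℕ} (a b ε : ℝ) (i : Fin (n + 1)) : ℝ → ℝ :=
  (if i = 0 then Set.Icc a b else Set.Icc (-a) a).indicator fun x => |x| ^ (ε - 1)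

theorem fibreWeight_nonneg {n : ℕ} (a b ε : ℝ) (i : Fin (n + 1)) (x : ℝ) :
    0 ≤ fibreWeight a b ε i x :=
  Set.indicator_nonneg (fun _ _ => by positivity) x

theorem integrable_fibreWeight {n : ℕ} {a b ε : ℝ} (ha : 0 < a) (hε : 0 < ε)
    (i : Fin (n + 1)) : Integrable (fibreWeight a b ε i) := by
  rw [fibreWeight]
  split_ifs with hi
  · rw [integrable_indicator_iff measurableSet_Icc]
    refine ContinuousOn.integrableOn_Icc (continuous_abs.continuousOn.rpow_const fun x hx => ?_)
    exact .inl (abs_pos_of_pos (ha.trans_le hx.1)).ne'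
  · rw [integrable_indicator_iff measurableSet_Icc]
    exact integrableOn_Icc_abs_rpow (by linarith) ha.le

theorem integral_fibreWeight_zero_le {n : ℕ} {a b ε : ℝ} (ha : 0 < a) (hab : a ≤ b)
    (hε : 0 < ε) (hε1 : ε ≤ 1) :
    ∫ x, fibreWeight a b ε (0 : Fin (n + 1)) x ≤ a ^ (ε - 1) * (b - a) := by
  have hint := integrable_fibreWeight (b := b) ha hε (0 : Fin (n + 1))
  rw [fibreWeight, if_pos rfl, integrable_indicator_iff measurableSet_Icc] at hint
  rw [fibreWeight, if_pos rfl, integral_indicator measurableSet_Icc]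
  calc ∫ x in Set.Icc a b, |x| ^ (ε - 1)
      ≤ ∫ _ in Set.Icc a b, a ^ (ε - 1) := by
        refine setIntegral_mono_on hint (by simp) measurableSet_Icc fun x hx => ?_
        exact rpow_le_rpow_of_nonpos ha (hx.1.trans (le_abs_self x)) (by linarith)
    _ = a ^ (ε - 1) * (b - a) := by
        rw [setIntegral_const, Real.volume_real_Icc_of_le hab, smul_eq_mul, mul_comm]

theorem integral_fibreWeight_succ {n : ℕ} {a b ε : ℝ} (ha : 0 < a) (hε : 0 < ε) (i : Fin n) :
    ∫ x, fibreWeight a b ε i.succ x = 2 * (a ^ ε / ε) := by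
  rw [fibreWeight, if_neg (Fin.succ_ne_zero i), integral_indicator measurableSet_Icc,
    setIntegral_Icc_abs_rpow (by linarith) ha.le, sub_add_cancel]

theorem g_eq_sinc : g = sinc := rfl

open Set in
/-- The integral over a convex subset of the slab, with a free exponent `ε`. -/
theorem abs_setIntegral_g_prod_le {n : ℕ} {a b ε : ℝ} (ha : 0 < a) (hab : a ≤ b)
    (hε : 0 < ε) (hε1 : ε ≤ 1) {E : Set (Fin (n + 2) → ℝ)} (hE : IsCompact E)
    (hconv : Convex ℝ E) (h0 : ∀ t ∈ E, t 0 ∈ Icc a b)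
    (hne : ∀ t ∈ E, ∀ i, i ≠ 0 → t i ∈ Icc (-a) a) :
    |∫ t in E, g (∏ i, t i)| ≤
      (2 * a) ^ ε * 8 ^ (1 - ε) * (a ^ (ε - 1) * (b - a) * (2 * (a ^ ε / ε)) ^ n) := by
  let ins : ℝ × (Fin (n + 1) → ℝ) → Fin (n + 2) → ℝ :=
    fun z => Fin.insertNth (α := fun _ => ℝ) 1 z.1 z.2
  have hins : Continuous ins := by fun_prop
  have hmp : MeasurePreserving ins :=
    (volume_preserving_piFinSuccAbove (fun _ : Fin (n + 2) => ℝ) 1).symm _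
  have hemb : MeasurableEmbedding ins :=
    (MeasurableEquiv.piFinSuccAbove (fun _ : Fin (n + 2) => ℝ) 1).symm.measurableEmbedding
  have hprod (z : ℝ × (Fin (n + 1) → ℝ)) : ∏ i, ins z i = (∏ i, z.2 i) * z.1 := by
    rw [Fin.prod_univ_succAbove _ 1, mul_comm]
    simp [ins]
  let F : (Fin (n + 2) → ℝ) → ℝ := E.indicator fun t => sinc (∏ i, t i)
  have hF : Integrable F := by
    rw [integrable_indicator_iff hE.measurableSet]
    exact (continuous_sinc.comp (by fun_prop)).continuousOn.integrableOn_compact hE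
  have hFins : Integrable (fun z => F (ins z)) := (hmp.integrable_comp_emb hemb).2 hF
  have hfibre (y : Fin (n + 1) → ℝ) : ∫ x, F (ins (x, y)) =
      ∫ x in {x | ins (x, y) ∈ E}, sinc ((∏ i, y i) * x) := by
    have hm : MeasurableSet {x | ins (x, y) ∈ E} :=
      (hE.isClosed.preimage (hins.comp (by fun_prop : Continuous fun x : ℝ => (x, y)))).measurableSet
    rw [← integral_indicator hm]
    congr 1 with x
    simp only [F, indicator, mem_ofPred_eq, hprod]
  have hbound : ∀ᵐ y : Fin (n + 1) → ℝ, ‖∫ x, F (ins (x, y))‖ ≤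
      (2 * a) ^ ε * 8 ^ (1 - ε) * ∏ i, fibreWeight a b ε i (y i) := by
    have hae : ∀ᵐ y : Fin (n + 1) → ℝ, ∀ i, y i ≠ 0 :=
      ae_all_iff.2 fun i => Measure.ae_eval_ne (μ := fun _ => volume) i 0
    filter_upwards [hae] with y hy
    have hp : ∏ i, y i ≠ 0 := Finset.prod_ne_zero_iff.2 fun i _ => hy i
    rw [hfibre, Real.norm_eq_abs]
    set S := {x | ins (x, y) ∈ E}
    rcases S.eq_empty_or_nonempty with hS | ⟨x, hx⟩
    · rw [hS, Measure.restrict_empty, integral_zero_measure, abs_zero]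
      have := Finset.prod_nonneg fun i (_ : i ∈ Finset.univ) => fibreWeight_nonneg a b ε i (y i)
      positivity
    have hsub : S ⊆ Icc (-a) a := fun x hx => by
      simpa [ins] using hne _ hx 1 (by simp)
    have hclosed : IsClosed S :=
      hE.isClosed.preimage (hins.comp (by fun_prop : Continuous fun x : ℝ => (x, y)))
    have hSconv : Convex ℝ S := by
      intro u hu v hv α β hα hβ hαβ
      have h := hconv hu hv hα hβ hαβ
      have heq : ins (α • u + β • v, y) = α • ins (u, y) + β • ins (v, y) := by
        rw [funext_iff, Fin.forall_iff_succAbove 1]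
        refine ⟨?_, fun j => ?_⟩
        · simp [ins]
        · simp [ins, ← add_mul, hαβ]
      change ins (α • u + β • v, y) ∈ E
      rwa [heq]
    refine (abs_setIntegral_sinc_mul_le_rpow (isCompact_Icc.of_isClosed_subset hclosed hsub)
      hSconv hp ha.le hsub hε hε1).trans_eq ?_
    rw [Finset.abs_prod, ← finsetProd_rpow _ _ fun i _ => abs_nonneg _]
    congr 1
    refine Finset.prod_congr rfl fun i _ => ?_
    rw [fibreWeight, indicator_of_mem]
    have hcoord : ins (x, y) (Fin.succAbove 1 i) = y i := by simp [ins]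
    split_ifs with hi
    · subst hi
      rw [← hcoord]
      exact h0 _ hx
    · rw [← hcoord]
      exact hne _ hx _ (by simpa [Fin.succAbove_eq_zero_iff] using hi)
  have hint : Integrable fun y : Fin (n + 1) → ℝ => ∏ i, fibreWeight a b ε i (y i) :=
    Integrable.fintype_prod fun i => integrable_fibreWeight ha hε i
  rw [g_eq_sinc, ← integral_indicator hE.measurableSet, ← hmp.integral_comp hemb F]
  calc |∫ z, F (ins z)| = ‖∫ y, ∫ x, F (ins (x, y))‖ := by
        rw [Real.norm_eq_abs, Measure.volume_eq_prod, integral_prod_symm _ hFins]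
    _ ≤ ∫ y : Fin (n + 1) → ℝ,
          (2 * a) ^ ε * 8 ^ (1 - ε) * ∏ i, fibreWeight a b ε i (y i) :=
        norm_integral_le_of_norm_le (hint.const_mul _) hbound
    _ ≤ _ := by
        rw [integral_const_mul, integral_fintype_prod_volume_eq_prod, Fin.prod_univ_succ]
        simp only [integral_fibreWeight_succ ha hε, Finset.prod_const, Finset.card_univ,
          Fintype.card_fin]
        gcongr
        exact integral_fibreWeight_zero_le ha hab hε hε1

theorem mul_rpow_inv_log_le {d N : ℝ} (hd : 0 < d) (hN : exp 1 ≤ N) :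
    (d * N) ^ (log N)⁻¹ ≤ (1 + d) * exp 1 := by
  have hNpos : 0 < N := (exp_pos 1).trans_le hN
  have hlog : 1 ≤ log N := (le_log_iff_exp_le hNpos).2 hN
  have hε1 : (log N)⁻¹ ≤ 1 := inv_le_one_of_one_le₀ hlog
  have hNε : N ^ (log N)⁻¹ = exp 1 := by
    rw [rpow_def_of_pos hNpos, mul_inv_cancel₀ (by linarith)]
  rw [mul_rpow hd.le hNpos.le, hNε]
  gcongr
  calc d ^ (log N)⁻¹ ≤ (1 + d) ^ (log N)⁻¹ := by
        have : 0 ≤ (log N)⁻¹ := by positivity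
        gcongr
        linarith
    _ ≤ (1 + d) ^ (1 : ℝ) := rpow_le_rpow_of_exponent_le (by linarith) hε1
    _ = 1 + d := rpow_one _

/-- Fix `k ≥ 2` and `0 < c < C`. There is `C' > 0` such that for all sufficiently large `N`
and every compact convex `D ⊆ [-CN, CN]^k`, the integral of `g (t₁ ⋯ t_k)` over
`D ∩ ([cN, CN] × [-cN, cN]^(k-1))` is at most `C' · (log N)^(k-2)` in absolute value. -/
theorem slab_integral_upper_bound (k : ℕ) (hk : 2 ≤ k) (c C : ℝ)
    (hc : 0 < c) (hcC : c < C) :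
    ∃ C' : ℝ, 0 < C' ∧ ∃ N₀ : ℝ, ∀ N : ℝ, N₀ ≤ N → ∀ D : Set (Fin k → ℝ),
      IsCompact D → Convex ℝ D →
      D ⊆ Set.Icc (fun _ : Fin k => -(C * N)) (fun _ : Fin k => C * N) →
      |∫ t in D ∩ {t : Fin k → ℝ |
          t ⟨0, by omega⟩ ∈ Set.Icc (c * N) (C * N) ∧
          ∀ i : Fin k, i ≠ ⟨0, by omega⟩ → t i ∈ Set.Icc (-(c * N)) (c * N)},
          g (∏ i, t i)| ≤ C' * (Real.log N) ^ (k - 2) := by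
  obtain ⟨n, rfl⟩ := Nat.exists_eq_add_of_le' hk
  have hCc : 0 < C - c := sub_pos.2 hcC
  refine ⟨(1 + 2 * c) * exp 1 * 8 *
    ((1 + c) * exp 1 * ((C - c) / c) * (2 * ((1 + c) * exp 1)) ^ n), by positivity, exp 1, ?_⟩
  intro N hN D hD hDconv _
  have hNpos : 0 < N := (exp_pos 1).trans_le hN
  have hlog : 1 ≤ log N := (le_log_iff_exp_le hNpos).2 hN
  have ha : 0 < c * N := by positivity
  set ε := (log N)⁻¹ with hεdef
  have hε : 0 < ε := by positivity
  have hε1 : ε ≤ 1 := inv_le_one_of_one_le₀ hlog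
  set T : Set (Fin (n + 2) → ℝ) := {t | t ⟨0, by omega⟩ ∈ Set.Icc (c * N) (C * N) ∧
    ∀ i : Fin (n + 2), i ≠ ⟨0, by omega⟩ → t i ∈ Set.Icc (-(c * N)) (c * N)} with hT
  have hTpi : T = Set.univ.pi fun i : Fin (n + 2) =>
      if i = 0 then Set.Icc (c * N) (C * N) else Set.Icc (-(c * N)) (c * N) := by
    ext t
    simp only [hT, Set.mem_ofPred_eq, Set.mem_univ_pi]
    refine ⟨fun h i => ?_, fun h => ⟨by simpa using h 0, fun i hi => ?_⟩⟩
    · split_ifs with hi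
      · exact hi ▸ h.1
      · exact h.2 i hi
    · have hi' : i ≠ 0 := hi
      simpa only [if_neg hi'] using h i
  have hTclosed : IsClosed T := by
    rw [hTpi]
    exact isClosed_set_pi fun i _ => by split_ifs <;> exact isClosed_Icc
  have hTconv : Convex ℝ T := by
    rw [hTpi]
    exact convex_pi fun i _ => by split_ifs <;> exact convex_Icc _ _
  have hmain := abs_setIntegral_g_prod_le ha (by gcongr : c * N ≤ C * N) hε hε1
    (hD.inter_right hTclosed) (hDconv.inter hTconv) (fun t ht => ht.2.1) (fun t ht => ht.2.2)
  refine hmain.trans ?_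
  have h8 : (8 : ℝ) ^ (1 - ε) ≤ 8 := by
    simpa using rpow_le_rpow_of_exponent_le (by norm_num : (1 : ℝ) ≤ 8)
      (by linarith : 1 - ε ≤ 1)
  have h2c : (2 * (c * N)) ^ ε ≤ (1 + 2 * c) * exp 1 := by
    rw [← mul_assoc]
    exact mul_rpow_inv_log_le (by positivity) hN
  have hcN : (c * N) ^ ε ≤ (1 + c) * exp 1 := mul_rpow_inv_log_le hc hN
  have hfirst : (c * N) ^ (ε - 1) * (C * N - c * N) = (c * N) ^ ε * ((C - c) / c) := by
    rw [rpow_sub_one ha.ne']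
    field_simp
  have hdiv : 2 * ((c * N) ^ ε / ε) = 2 * (c * N) ^ ε * log N := by
    rw [hεdef, div_inv_eq_mul]
    ring
  rw [hfirst, hdiv, Nat.add_sub_cancel, mul_pow, ← mul_assoc ((c * N) ^ ε * _), ← mul_assoc]
  gcongr
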